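/- arXiv:2602.06754 — 4 statements merged into one kernel-verified Lean document; each statement's English description precedes it below -/
import Mathlib

section
/- Let Σ be a nonempty finite set, let τ : Σ → ℝ, and let G = (G_u)_{u∈Σ} be a random vector whose coordinates are i.i.d. with the standard Gumbel distribution. Let U* = argmax_{v∈Σ}(G_v + τ_v) (almost surely unique) and let r ∈ Δ(Σ) be the softmax distribution r_u = e^{τ_u}/Σ_{v∈Σ} e^{τ_v}. Then E[G_{U*}] = γ + H(r), where H(r) = −Σ_{u∈Σ} r_u log r_u is the Shannon entropy and γ is the Euler–Mascheroni constant. -/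
open Finset MeasureTheory

theorem integral_log_mul_exp_neg_Ioi :
    ∫ t in Set.Ioi (0 : ℝ), Real.log t * Real.exp (-t) = -Real.eulerMascheroniConstant := by
  have hΓ := Complex.hasDerivAt_GammaIntegral (s := 1) (by simp)
  have heq : Complex.Gamma =ᶠ[nhds 1] Complex.GammaIntegral := by
    have : ∀ᶠ s : ℂ in nhds 1, 0 < s.re :=
      Complex.continuous_re.continuousAt.eventually (lt_mem_nhds (by simp))
    filter_upwards [this] with s hs using Complex.Gamma_eq_integral hs
  have h := (hΓ.congr_of_eventuallyEq heq).unique Complex.hasDerivAt_Gamma_one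
  simp only [sub_self, Complex.cpow_zero, one_mul] at h
  have hcast : ∫ t in Set.Ioi (0 : ℝ), ((Real.log t : ℂ) * (Real.exp (-t) : ℂ)) =
      ((∫ t in Set.Ioi (0 : ℝ), Real.log t * Real.exp (-t) : ℝ) : ℂ) := by
    rw [← integral_complex_ofReal]
    simp only [Complex.ofReal_mul]
  rw [hcast] at h
  exact_mod_cast h

theorem integrableOn_log_mul_exp_neg_Ioi :
    IntegrableOn (fun t => Real.log t * Real.exp (-t)) (Set.Ioi 0) := by
  by_contra h
  have h0 := integral_log_mul_exp_neg_Ioi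
  rw [integral_undef h] at h0
  linarith [Real.one_half_lt_eulerMascheroniConstant]

/-- A law on `ℝ` is a Gumbel law with location `L` as soon as its distribution function is
`exp (-exp (L - x))`; such a law is the image of the unit exponential law under `L - log t`. -/
theorem eq_map_of_gumbel_cdf (ρ : Measure ℝ) [IsFiniteMeasure ρ] (L : ℝ)
    (h : ∀ x, ρ (Set.Iic x) = ENNReal.ofReal (Real.exp (-Real.exp (L - x)))) :
    ρ = ((volume.restrict (Set.Ioi (0 : ℝ))).withDensity
      (fun t => ENNReal.ofReal (Real.exp (-t)))).map (fun t => L - Real.log t) := by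
  refine Measure.ext_of_Iic _ _ fun x => ?_
  rw [h, Measure.map_apply (by fun_prop) measurableSet_Iic,
    withDensity_apply _ (measurableSet_Iic.preimage (by fun_prop)),
    Measure.restrict_restrict (measurableSet_Iic.preimage (by fun_prop))]
  have hset : (fun t => L - Real.log t) ⁻¹' Set.Iic x ∩ Set.Ioi 0 =
      Set.Ici (Real.exp (L - x)) := by
    ext t
    simp only [Set.mem_inter_iff, Set.mem_preimage, Set.mem_Iic, Set.mem_Ioi, Set.mem_Ici]
    constructor
    · rintro ⟨h1, h2⟩
      rw [← Real.le_log_iff_exp_le h2]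
      linarith
    · intro h1
      have h2 : 0 < t := (Real.exp_pos _).trans_le h1
      refine ⟨?_, h2⟩
      rw [← Real.le_log_iff_exp_le h2] at h1
      linarith
  rw [hset, setLIntegral_congr Ioi_ae_eq_Ici.symm,
    ← ofReal_integral_eq_lintegral_ofReal (integrableOn_exp_neg_Ioi _)
      (Filter.Eventually.of_forall fun t => (Real.exp_pos _).le), integral_exp_neg_Ioi]

theorem integrable_and_integral_of_gumbel_cdf (ρ : Measure ℝ) [IsFiniteMeasure ρ] (L : ℝ)
    (h : ∀ x, ρ (Set.Iic x) = ENNReal.ofReal (Real.exp (-Real.exp (L - x)))) :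
    Integrable id ρ ∧ ∫ x, x ∂ρ = L + Real.eulerMascheroniConstant := by
  have hfin : ∀ᵐ t ∂(volume.restrict (Set.Ioi (0 : ℝ))),
      ENNReal.ofReal (Real.exp (-t)) < ⊤ := by simp
  have hmeas : Measurable fun t : ℝ => ENNReal.ofReal (Real.exp (-t)) := by fun_prop
  have hfun : (fun t : ℝ => (ENNReal.ofReal (Real.exp (-t))).toReal • (L - Real.log t)) =
      fun t => L * Real.exp (-t) - Real.log t * Real.exp (-t) := by
    funext t
    rw [ENNReal.toReal_ofReal (Real.exp_pos _).le, smul_eq_mul]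
    ring
  have hexp := (integrableOn_exp_neg_Ioi 0).const_mul L
  rw [eq_map_of_gumbel_cdf ρ L h]
  constructor
  · rw [integrable_map_measure (by fun_prop) (by fun_prop)]
    refine (integrable_withDensity_iff_integrable_smul' hmeas hfin).2 ?_
    simp only [Function.comp_apply, id, hfun]
    exact hexp.sub integrableOn_log_mul_exp_neg_Ioi
  · rw [integral_map (by fun_prop) (by fun_prop),
      integral_withDensity_eq_integral_toReal_smul hmeas hfin, hfun,
      integral_sub hexp integrableOn_log_mul_exp_neg_Ioi, integral_const_mul,
      integral_exp_neg_Ioi_zero, integral_log_mul_exp_neg_Ioi]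
    ring

/-- The maximum of independent shifted Gumbel variables is integrable, with mean the Euler
constant plus the log-sum-exp of the shifts. -/
theorem integrable_and_integral_sup'_gumbel {V : Type*} [Fintype V] [Nonempty V]
    {Ω : Type*} [MeasurableSpace Ω] (μ : Measure Ω) [IsProbabilityMeasure μ]
    (G : Ω → V → ℝ) (hG : Measurable G)
    (ν : Measure ℝ) [IsProbabilityMeasure ν]
    (hcdf : ∀ x : ℝ, ν (Set.Iic x) = ENNReal.ofReal (Real.exp (-Real.exp (-x))))
    (hlaw : Measure.map G μ = Measure.pi (fun _ : V => ν)) (τ : V → ℝ) :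
    Integrable (fun ω => univ.sup' univ_nonempty fun v => G ω v + τ v) μ ∧
      ∫ ω, univ.sup' univ_nonempty (fun v => G ω v + τ v) ∂μ =
        Real.log (∑ v, Real.exp (τ v)) + Real.eulerMascheroniConstant := by
  set W : Ω → ℝ := fun ω => univ.sup' univ_nonempty fun v => G ω v + τ v with hW
  have hWm : Measurable W := by
    have := Finset.measurable_sup' (s := (univ : Finset V)) univ_nonempty
      (f := fun v ω => G ω v + τ v) fun v _ => (hG.eval (a := v)).add_const _
    convert this using 1
    funext ω
    simp [hW, Finset.sup'_apply]
  have : IsProbabilityMeasure (μ.map W) := Measure.isProbabilityMeasure_map hWm.aemeasurable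
  have hZ : 0 < ∑ v, Real.exp (τ v) := sum_pos (fun v _ => Real.exp_pos _) univ_nonempty
  have hWcdf : ∀ x, μ.map W (Set.Iic x) = ENNReal.ofReal
      (Real.exp (-Real.exp (Real.log (∑ v, Real.exp (τ v)) - x))) := by
    intro x
    have hset : W ⁻¹' Set.Iic x = G ⁻¹' Set.univ.pi fun v => Set.Iic (x - τ v) := by
      ext ω
      simp [hW, Pi.le_def, le_sub_iff_add_le]
    rw [Measure.map_apply hWm measurableSet_Iic, hset,
      ← Measure.map_apply hG (.univ_pi fun v => measurableSet_Iic), hlaw, Measure.pi_pi]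
    simp only [hcdf]
    rw [← ENNReal.ofReal_prod_of_nonneg fun v _ => (Real.exp_pos _).le, ← Real.exp_sum,
      sum_neg_distrib, Real.exp_sub, Real.exp_log hZ, sum_div]
    simp only [neg_sub, Real.exp_sub]
  obtain ⟨h1, h2⟩ := integrable_and_integral_of_gumbel_cdf _ _ hWcdf
  rw [integrable_map_measure (by fun_prop) hWm.aemeasurable] at h1
  rw [integral_map hWm.aemeasurable (by fun_prop)] at h2
  exact ⟨h1, h2⟩

theorem stmt_7 {V : Type*} [Fintype V] [Nonempty V]
    {Ω : Type*} [MeasurableSpace Ω] (μ : Measure Ω) [IsProbabilityMeasure μ]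
    (G : Ω → V → ℝ) (hG : Measurable G)
    (ν : Measure ℝ) [IsProbabilityMeasure ν]
    -- `ν` is the standard Gumbel law: CDF `F(x) = exp (−exp (−x))`
    (hcdf : ∀ x : ℝ, ν (Set.Iic x) = ENNReal.ofReal (Real.exp (-Real.exp (-x))))
    -- the coordinates of `G` are i.i.d. with law `ν`
    (hlaw : Measure.map G μ = Measure.pi (fun _ : V => ν))
    (τ : V → ℝ)
    -- the softmax distribution `r_u = e^{τ_u} / ∑ v, e^{τ_v}`
    (r : V → ℝ) (hr : ∀ u, r u = Real.exp (τ u) / ∑ v, Real.exp (τ v))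
    -- `U*` is the argmax of `v ↦ G_v + τ_v` (a.s. unique)
    (U : Ω → V) (hUmeas : ∀ u : V, MeasurableSet {ω | U ω = u})
    (hU : ∀ᵐ ω ∂μ, ∀ v : V, G ω v + τ v ≤ G ω (U ω) + τ (U ω)) :
    -- `E[G_{U*}] = γ + H(r)` where `H` is the Shannon entropy
    ∫ ω, G ω (U ω) ∂μ =
      Real.eulerMascheroniConstant + (- ∑ u, r u * Real.log (r u)) := by
  have hZ : 0 < ∑ v, Real.exp (τ v) := sum_pos (fun v _ => Real.exp_pos _) univ_nonempty
  have hmax := fun s : ℝ =>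
    integrable_and_integral_sup'_gumbel μ G hG ν hcdf hlaw (fun v => s * τ v)
  have hτm : Measurable fun ω => τ (U ω) := by
    let _ : MeasurableSpace V := ⊤
    have hU' : Measurable U := measurable_to_countable' hUmeas
    exact (measurable_from_top (f := τ)).comp hU'
  have hτi : Integrable (fun ω => τ (U ω)) μ := by
    refine .of_bound hτm.aestronglyMeasurable (∑ v, ‖τ v‖) (.of_forall fun ω => ?_)
    exact single_le_sum (f := fun v => ‖τ v‖) (fun v _ => norm_nonneg _) (mem_univ _)
  have hGU : (fun ω => G ω (U ω)) =ᵐ[μ] fun ω =>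
      univ.sup' univ_nonempty (fun v => G ω v + 1 * τ v) - τ (U ω) := by
    filter_upwards [hU] with ω hω
    have : univ.sup' univ_nonempty (fun v => G ω v + 1 * τ v) = G ω (U ω) + τ (U ω) := by
      simp only [one_mul]
      exact le_antisymm (sup'_le _ _ fun v _ => hω v)
        (le_sup' (fun v => G ω v + τ v) (mem_univ (U ω)))
    rw [this, add_sub_cancel_right]
  have hGi : Integrable (fun ω => G ω (U ω)) μ := ((hmax 1).1.sub hτi).congr hGU.symm
  have hGint : ∫ ω, G ω (U ω) ∂μ = Real.log (∑ v, Real.exp (τ v)) +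
      Real.eulerMascheroniConstant - ∫ ω, τ (U ω) ∂μ := by
    rw [integral_congr_ae hGU, integral_sub (hmax 1).1 hτi, (hmax 1).2]
    simp only [one_mul]
  -- Suboptimality of `U` for the shifts `s * τ`, with equality at `s = 1`, identifies the mean of
  -- `τ ∘ U` as a derivative of the log-sum-exp.
  have hτint : ∑ u, r u * τ u = ∫ ω, τ (U ω) ∂μ := by
    have hle : ∀ s : ℝ, ∫ ω, G ω (U ω) ∂μ + s * ∫ ω, τ (U ω) ∂μ ≤
        Real.log (∑ v, Real.exp (s * τ v)) + Real.eulerMascheroniConstant := by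
      intro s
      rw [← (hmax s).2, ← integral_const_mul, ← integral_add hGi (hτi.const_mul s)]
      exact integral_mono (hGi.add (hτi.const_mul s)) (hmax s).1 fun ω =>
        le_sup' (fun v => G ω v + s * τ v) (mem_univ (U ω))
    have hmin : IsLocalMin
        (fun s : ℝ => Real.log (∑ v, Real.exp (s * τ v)) - s * ∫ ω, τ (U ω) ∂μ) 1 := by
      refine .of_forall fun s => ?_
      have := hle s
      simp only [one_mul]
      linarith
    have hd : HasDerivAt (fun s : ℝ => ∑ v, Real.exp (s * τ v))
        (∑ v, Real.exp (1 * τ v) * (1 * τ v)) 1 :=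
      HasDerivAt.fun_sum fun v _ => ((hasDerivAt_id' (1 : ℝ)).mul_const (τ v)).exp
    have h0 := hmin.hasDerivAt_eq_zero
      ((hd.log (by simpa using hZ.ne')).sub ((hasDerivAt_id' (1 : ℝ)).mul_const _))
    simp only [one_mul] at h0
    rw [← sub_eq_zero, ← h0, sum_div]
    congr 1
    exact sum_congr rfl fun u _ => by rw [hr]; ring
  have hrsum : ∑ u, r u = 1 := by
    simp only [hr, ← sum_div]
    exact div_self hZ.ne'
  have hent : ∑ u, r u * Real.log (r u) =
      ∑ u, r u * τ u - Real.log (∑ v, Real.exp (τ v)) := by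
    have : ∀ u, r u * Real.log (r u) =
        r u * τ u - r u * Real.log (∑ v, Real.exp (τ v)) := fun u => by
      rw [← mul_sub]
      congr 1
      rw [hr, Real.log_div (Real.exp_ne_zero _) hZ.ne', Real.log_exp]
    simp only [this, sum_sub_distrib, ← sum_mul, hrsum, one_mul]
  rw [hGint, hent, hτint]
  ring
end

section
/- Let Σ be a nonempty finite set, let p ∈ Δ(Σ) have full support, let G = (G_u)_{u∈Σ} be a random vector whose coordinates are i.i.d. with the standard Gumbel distribution, and let ε ≥ 0. Consider the problem of maximizing E[Σ_{u∈Σ} G_u q(G)_u] over measurable functions q : ℝ^Σ → Δ(Σ) subject to KL(E[q(G)] ‖ p) ≤ ε. Then there exists α ∈ [0,1] such that the function q*(g)_u = 1{u = argmax_{v∈Σ}(g_v + α log p_v)} is an optimal solution, where α is chosen so that KL(E[q*(G)] ‖ p) = ε if such α ∈ [0,1] exists, and α = 0 otherwise. -/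
open Finset MeasureTheory

/-- The probability simplex on a finite type `V`. -/
def simplex (V : Type*) [Fintype V] : Set (V → ℝ) :=
  {q | (∀ u, 0 ≤ q u) ∧ ∑ u, q u = 1}

/-- KL divergence `KL(q ‖ p) = ∑ u, q u * log (q u / p u)`
(the convention `0 · log 0 = 0` holds automatically). -/
noncomputable def KL {V : Type*} [Fintype V] (q p : V → ℝ) : ℝ :=
  ∑ u, q u * Real.log (q u / p u)

/-- A choice of maximizer of `f : V → ℝ`. -/
noncomputable def argmaxOf {V : Type*} [Fintype V] [Nonempty V] (f : V → ℝ) : V :=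
  (Finset.exists_max_image Finset.univ f Finset.univ_nonempty).choose

open Classical in
/-- The deterministic sampling rule `q*(g)_u = 1{u = argmax_v (g_v + α log p_v)}`. -/
noncomputable def qArgmax {V : Type*} [Fintype V] [Nonempty V] (p : V → ℝ) (α : ℝ) :
    (V → ℝ) → V → ℝ :=
  fun g u => if u = argmaxOf (fun v => g v + α * Real.log (p v)) then 1 else 0

/-- The simplex-weighted average of `f` is at most its maximum. -/
lemma sum_mul_le_sup' {V : Type*} [Fintype V] [Nonempty V] {q : V → ℝ} (hq : q ∈ simplex V)
    (f : V → ℝ) : ∑ u, f u * q u ≤ univ.sup' univ_nonempty f :=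
  calc ∑ u, f u * q u ≤ ∑ u, univ.sup' univ_nonempty f * q u :=
        sum_le_sum fun u _ => mul_le_mul_of_nonneg_right (le_sup' f (mem_univ u)) (hq.1 u)
    _ = univ.sup' univ_nonempty f := by rw [← mul_sum, hq.2, mul_one]

lemma le_one_of_mem_simplex {V : Type*} [Fintype V] {q : V → ℝ} (hq : q ∈ simplex V) (u : V) :
    q u ≤ 1 :=
  hq.2 ▸ single_le_sum (fun v _ => hq.1 v) (mem_univ u)

lemma le_argmaxOf {V : Type*} [Fintype V] [Nonempty V] (f : V → ℝ) (v : V) :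
    f v ≤ f (argmaxOf f) :=
  (exists_max_image univ f univ_nonempty).choose_spec.2 v (mem_univ v)

/-- `argmaxOf f` depends on `f` only through its set of maximizers. -/
lemma argmaxOf_congr {V : Type*} [Fintype V] [Nonempty V] {f g : V → ℝ}
    (h : ∀ u, (∀ v, f v ≤ f u) ↔ ∀ v, g v ≤ g u) : argmaxOf f = argmaxOf g := by
  have key : (fun u => u ∈ univ ∧ ∀ v ∈ univ, f v ≤ f u) =
      fun u => u ∈ univ ∧ ∀ v ∈ univ, g v ≤ g u := by
    funext u
    simpa using h u
  unfold argmaxOf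
  congr 1

lemma measurableSet_argmaxOf_eq {V : Type*} [Fintype V] [Nonempty V] (u : V) :
    MeasurableSet {f : V → ℝ | argmaxOf f = u} := by
  classical
  let S : (V → ℝ) → Set V := fun f => {w | ∀ v, f v ≤ f w}
  have hS : Measurable S := by
    refine measurable_set_iff.2 fun w => ?_
    refine measurable_to_prop ?_
    have : (fun f => w ∈ S f) ⁻¹' {True} = ⋂ v, {f : V → ℝ | f v ≤ f w} := by
      ext f; simp [S]
    rw [this]
    exact MeasurableSet.iInter fun v =>
      measurableSet_le (measurable_pi_apply v) (measurable_pi_apply w)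
  have : {f : V → ℝ | argmaxOf f = u} =
      ⋃ T ∈ {T : Set V | ∃ f, S f = T ∧ argmaxOf f = u}, S ⁻¹' {T} := by
    ext f
    simp only [Set.mem_ofPred_eq, Set.mem_iUnion, Set.mem_preimage, Set.mem_singleton_iff]
    constructor
    · exact fun h => ⟨S f, ⟨f, rfl, h⟩, rfl⟩
    · rintro ⟨T, ⟨g, hg, hu⟩, hf⟩
      rw [← hu]
      exact argmaxOf_congr fun w => Set.ext_iff.1 (hf.trans hg.symm) w
  rw [this]
  refine MeasurableSet.biUnion (Set.to_countable _) fun T _ => ?_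
  have hT : S ⁻¹' {T} = ⋂ w, {f | w ∈ S f ↔ w ∈ T} := by
    ext f; simp [Set.ext_iff]
  rw [hT]
  refine MeasurableSet.iInter fun w => ?_
  exact measurableSet_setOfPred.2 ((measurable_set_iff.1 hS w).iff measurable_const)

lemma measurable_qArgmax {V : Type*} [Fintype V] [Nonempty V] (p : V → ℝ) (α : ℝ) :
    Measurable (qArgmax p α) := by
  classical
  refine measurable_pi_lambda _ fun u => ?_
  have hm : Measurable fun (g : V → ℝ) v => g v + α * Real.log (p v) := by fun_prop
  have hs := hm (measurableSet_argmaxOf_eq u)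
  unfold qArgmax
  refine Measurable.ite ?_ measurable_const measurable_const
  convert hs using 1
  ext g
  simp [eq_comm]

lemma sum_mul_qArgmax {V : Type*} [Fintype V] [Nonempty V] (p : V → ℝ) (α : ℝ) (g f : V → ℝ) :
    ∑ u, f u * qArgmax p α g u = f (argmaxOf fun v => g v + α * Real.log (p v)) := by
  classical
  simp [qArgmax]

lemma qArgmax_mem_simplex {V : Type*} [Fintype V] [Nonempty V] (p : V → ℝ) (α : ℝ) (g : V → ℝ) :
    qArgmax p α g ∈ simplex V := by
  refine ⟨fun u => ?_, by simpa using sum_mul_qArgmax p α g 1⟩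
  unfold qArgmax
  split_ifs <;> norm_num

lemma sum_add_mul_qArgmax {V : Type*} [Fintype V] [Nonempty V] (p : V → ℝ) (α : ℝ) (g : V → ℝ) :
    ∑ u, (g u + α * Real.log (p u)) * qArgmax p α g u =
      univ.sup' univ_nonempty fun u => g u + α * Real.log (p u) := by
  refine (sum_mul_le_sup' (qArgmax_mem_simplex p α g) _).antisymm ?_
  rw [sum_mul_qArgmax p α g fun u => g u + α * Real.log (p u)]
  exact sup'_le _ _ fun v _ => le_argmaxOf (fun v => g v + α * Real.log (p v)) v

/-- `KL(q ‖ p)` as a `p`-average of the nonnegative function `klFun`. -/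
lemma KL_eq_sum_klFun {V : Type*} [Fintype V] {q p : V → ℝ} (hq : q ∈ simplex V)
    (hp : p ∈ simplex V) (hppos : ∀ u, 0 < p u) :
    KL q p = ∑ u, p u * InformationTheory.klFun (q u / p u) := by
  have h : ∀ u, p u * InformationTheory.klFun (q u / p u) =
      q u * Real.log (q u / p u) + (p u - q u) := fun u => by
    have := (hppos u).ne'
    rw [InformationTheory.klFun]
    field_simp
    ring
  simp_rw [h, sum_add_distrib, sum_sub_distrib, hq.2, hp.2, KL]
  ring

lemma mul_klFun_nonneg {V : Type*} [Fintype V] {q p : V → ℝ} (hq : q ∈ simplex V)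
    (hppos : ∀ u, 0 < p u) (u : V) : 0 ≤ p u * InformationTheory.klFun (q u / p u) :=
  mul_nonneg (hppos u).le (InformationTheory.klFun_nonneg (div_nonneg (hq.1 u) (hppos u).le))

lemma KL_nonneg {V : Type*} [Fintype V] {q p : V → ℝ} (hq : q ∈ simplex V)
    (hp : p ∈ simplex V) (hppos : ∀ u, 0 < p u) : 0 ≤ KL q p := by
  rw [KL_eq_sum_klFun hq hp hppos]
  exact sum_nonneg fun u _ => mul_klFun_nonneg hq hppos u

lemma eq_of_KL_nonpos {V : Type*} [Fintype V] {q p : V → ℝ} (hq : q ∈ simplex V)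
    (hp : p ∈ simplex V) (hppos : ∀ u, 0 < p u) (h : KL q p ≤ 0) : q = p := by
  have h0 := h.antisymm (KL_nonneg hq hp hppos)
  rw [KL_eq_sum_klFun hq hp hppos,
    sum_eq_zero_iff_of_nonneg fun u _ => mul_klFun_nonneg hq hppos u] at h0
  funext u
  have h1 := (mul_eq_zero.1 (h0 u (mem_univ u))).resolve_left (hppos u).ne'
  rw [InformationTheory.klFun_eq_zero_iff (div_nonneg (hq.1 u) (hppos u).le)] at h1
  exact (div_eq_one_iff_eq (hppos u).ne').1 h1

lemma KL_eq_sub {V : Type*} [Fintype V] (q : V → ℝ) {p : V → ℝ} (hppos : ∀ u, 0 < p u) :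
    KL q p = ∑ u, q u * Real.log (q u) - ∑ u, q u * Real.log (p u) := by
  rw [KL, ← sum_sub_distrib]
  refine sum_congr rfl fun u _ => ?_
  by_cases h : q u = 0
  · simp [h]
  · rw [Real.log_div h (hppos u).ne']
    ring

/-- The softmax distribution with weights `c`. -/
noncomputable def softmax {V : Type*} [Fintype V] (c : V → ℝ) (u : V) : ℝ :=
  Real.exp (c u) / ∑ v, Real.exp (c v)

lemma sum_exp_pos {V : Type*} [Fintype V] [Nonempty V] (c : V → ℝ) : 0 < ∑ v, Real.exp (c v) :=
  sum_pos (fun _ _ => Real.exp_pos _) univ_nonempty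

lemma softmax_pos {V : Type*} [Fintype V] [Nonempty V] (c : V → ℝ) (u : V) : 0 < softmax c u :=
  div_pos (Real.exp_pos _) (sum_exp_pos c)

lemma softmax_mem_simplex {V : Type*} [Fintype V] [Nonempty V] (c : V → ℝ) :
    softmax c ∈ simplex V :=
  ⟨fun u => (softmax_pos c u).le, by
    simp_rw [softmax, ← sum_div]
    exact div_self (sum_exp_pos c).ne'⟩

lemma softmax_log {V : Type*} [Fintype V] {p : V → ℝ} (hp : p ∈ simplex V)
    (hppos : ∀ u, 0 < p u) : (softmax fun u => Real.log (p u)) = p := by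
  funext u
  simp_rw [softmax, fun v => Real.exp_log (hppos v), hp.2, div_one]

lemma log_softmax {V : Type*} [Fintype V] [Nonempty V] (c : V → ℝ) (u : V) :
    Real.log (softmax c u) = c u - Real.log (∑ v, Real.exp (c v)) := by
  rw [softmax, Real.log_div (Real.exp_pos _).ne' (sum_exp_pos c).ne', Real.log_exp]

lemma sum_mul_log_softmax {V : Type*} [Fintype V] [Nonempty V] {q : V → ℝ} (hq : q ∈ simplex V)
    (c : V → ℝ) : ∑ u, q u * Real.log (softmax c u) =
      ∑ u, c u * q u - Real.log (∑ v, Real.exp (c v)) := by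
  simp_rw [log_softmax, mul_sub, sum_sub_distrib, ← sum_mul, hq.2, one_mul, mul_comm]

/-- A subgradient of log-sum-exp is its gradient, the softmax. -/
lemma eq_softmax_of_forall_le {V : Type*} [Fintype V] [Nonempty V] {m c₀ : V → ℝ}
    (h : ∀ c : V → ℝ, Real.log (∑ v, Real.exp (c₀ v)) - ∑ v, c₀ v * m v ≤
      Real.log (∑ v, Real.exp (c v)) - ∑ v, c v * m v) : m = softmax c₀ := by
  classical
  funext u
  let e : V → ℝ := Pi.single u 1
  let f : ℝ → ℝ := fun t => Real.log (∑ v, Real.exp (c₀ v + t * e v)) -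
    ∑ v, (c₀ v + t * e v) * m v
  have hmin : IsLocalMin f 0 := Filter.Eventually.of_forall fun t => by
    simpa [f] using h fun v => c₀ v + t * e v
  have hlin : ∀ v, HasDerivAt (fun t : ℝ => c₀ v + t * e v) (e v) 0 := fun v => by
    simpa using ((hasDerivAt_id (0 : ℝ)).mul_const (e v)).const_add (c₀ v)
  have hd : HasDerivAt f (softmax c₀ u - m u) 0 := by
    have h1 := (HasDerivAt.fun_sum (u := univ) fun v _ => (hlin v).exp).log (by
      simpa using (sum_exp_pos c₀).ne')
    have h2 := HasDerivAt.fun_sum (u := univ) fun v _ => (hlin v).mul_const (m v)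
    refine (h1.sub h2).congr_deriv ?_
    simp [softmax, e, Pi.single_apply]
  linarith [hmin.hasDerivAt_eq_zero hd]

section Gumbel

variable {ν : Measure ℝ} [IsProbabilityMeasure ν]

/-- The Gumbel law has a finite first moment. -/
lemma integrable_id_of_gumbel
    (hcdf : ∀ x : ℝ, ν (Set.Iic x) = ENNReal.ofReal (Real.exp (-Real.exp (-x)))) :
    Integrable (fun x : ℝ => x) ν := by
  refine ⟨measurable_id.aestronglyMeasurable, ?_⟩
  rw [hasFiniteIntegral_iff_norm]
  rw [lintegral_eq_lintegral_meas_lt ν (Filter.Eventually.of_forall fun x => norm_nonneg x)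
    (by fun_prop)]
  have hb : ∀ t : ℝ, ν {x | t < ‖x‖} ≤ ENNReal.ofReal (2 * Real.exp (-t)) := fun t => by
    have hsub : {x : ℝ | t < ‖x‖} ⊆ Set.Iic (-t) ∪ (Set.Iic t)ᶜ := fun x hx => by
      simp only [Set.mem_ofPred_eq, Real.norm_eq_abs, lt_abs] at hx
      rcases hx with hx | hx
      · right; simpa using hx
      · left; simp only [Set.mem_Iic]; linarith
    have h1 : ν (Set.Iic (-t)) ≤ ENNReal.ofReal (Real.exp (-t)) := by
      rw [hcdf, neg_neg]
      gcongr
      linarith [Real.add_one_le_exp t]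
    have h2 : ν (Set.Iic t)ᶜ ≤ ENNReal.ofReal (Real.exp (-t)) := by
      rw [prob_compl_eq_one_sub measurableSet_Iic, hcdf, ← ENNReal.ofReal_one,
        ← ENNReal.ofReal_sub _ (Real.exp_pos _).le]
      refine ENNReal.ofReal_le_ofReal ?_
      linarith [Real.add_one_le_exp (-Real.exp (-t))]
    calc ν {x | t < ‖x‖} ≤ ν (Set.Iic (-t)) + ν (Set.Iic t)ᶜ :=
          (measure_mono hsub).trans (measure_union_le _ _)
      _ ≤ _ := add_le_add h1 h2
      _ = _ := by
          rw [← ENNReal.ofReal_add (Real.exp_pos _).le (Real.exp_pos _).le, two_mul]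
  refine (lintegral_mono hb).trans_lt ?_
  exact ((integrableOn_exp_neg_Ioi 0).const_mul 2).lintegral_lt_top

variable {V : Type*} [Fintype V] {Ω : Type*} [MeasurableSpace Ω] {μ : Measure Ω}
  {G : Ω → V → ℝ}

lemma integrable_coord_of_gumbel (hG : Measurable G)
    (hcdf : ∀ x : ℝ, ν (Set.Iic x) = ENNReal.ofReal (Real.exp (-Real.exp (-x))))
    (hlaw : Measure.map G μ = Measure.pi (fun _ : V => ν)) (u : V) :
    Integrable (fun ω => G ω u) μ := by
  have h1 : Integrable (fun g : V → ℝ => g u) (Measure.map G μ) := by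
    rw [hlaw]
    exact (measurePreserving_eval (fun _ : V => ν) u).integrable_comp_of_integrable
      (integrable_id_of_gumbel hcdf)
  exact h1.comp_measurable hG

lemma measurable_sup'_add [Nonempty V] (hG : Measurable G) (c : V → ℝ) :
    Measurable fun ω => univ.sup' univ_nonempty fun v => G ω v + c v := by
  have : Measurable (univ.sup' univ_nonempty fun v ω => G ω v + c v) :=
    measurable_sup' _ fun v _ => by fun_prop
  convert this using 2 with ω
  simp

/-- Max-stability: the maximum of shifted Gumbel variables is Gumbel shifted by the
log-sum-exp of the shifts. -/
lemma map_sup'_of_gumbel [Nonempty V] (hG : Measurable G)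
    (hcdf : ∀ x : ℝ, ν (Set.Iic x) = ENNReal.ofReal (Real.exp (-Real.exp (-x))))
    (hlaw : Measure.map G μ = Measure.pi (fun _ : V => ν)) (c : V → ℝ) :
    Measure.map (fun ω => univ.sup' univ_nonempty fun v => G ω v + c v) μ =
      Measure.map (fun x => x + Real.log (∑ v, Real.exp (c v))) ν := by
  have hm := measurable_sup'_add hG c
  have hm' : Measurable fun x : ℝ => x + Real.log (∑ v, Real.exp (c v)) := by fun_prop
  have := Measure.isProbabilityMeasure_map (μ := ν) hm'.aemeasurable
  refine (Measure.ext_of_Iic _ _ fun x => ?_).symm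
  rw [Measure.map_apply hm measurableSet_Iic, Measure.map_apply hm' measurableSet_Iic]
  have h1 : (fun x => x + Real.log (∑ v, Real.exp (c v))) ⁻¹' Set.Iic x =
      Set.Iic (x - Real.log (∑ v, Real.exp (c v))) := by
    ext y; simp [le_sub_iff_add_le]
  have h2 : (fun ω => univ.sup' univ_nonempty fun v => G ω v + c v) ⁻¹' Set.Iic x =
      G ⁻¹' Set.univ.pi fun v => Set.Iic (x - c v) := by
    ext ω; simp [Pi.le_def, le_sub_iff_add_le]
  rw [h1, h2, ← Measure.map_apply hG (MeasurableSet.univ_pi fun v => measurableSet_Iic), hlaw,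
    Measure.pi_pi]
  simp_rw [hcdf]
  rw [← ENNReal.ofReal_prod_of_nonneg fun _ _ => (Real.exp_pos _).le, ← Real.exp_sum,
    sum_neg_distrib]
  congr 3
  simp_rw [neg_sub, Real.exp_sub, ← sum_div, Real.exp_log (sum_exp_pos c)]

lemma integral_sup'_of_gumbel [Nonempty V] (hG : Measurable G)
    (hcdf : ∀ x : ℝ, ν (Set.Iic x) = ENNReal.ofReal (Real.exp (-Real.exp (-x))))
    (hlaw : Measure.map G μ = Measure.pi (fun _ : V => ν)) (c : V → ℝ) :
    Integrable (fun ω => univ.sup' univ_nonempty fun v => G ω v + c v) μ ∧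
    ∫ ω, (univ.sup' univ_nonempty fun v => G ω v + c v) ∂μ =
      ∫ x, x ∂ν + Real.log (∑ v, Real.exp (c v)) := by
  have hm := measurable_sup'_add hG c
  have hi := integrable_id_of_gumbel hcdf
  have hlaw' := map_sup'_of_gumbel hG hcdf hlaw c
  have hm' : Measurable fun x : ℝ => x + Real.log (∑ v, Real.exp (c v)) := by fun_prop
  have hi' : Integrable (fun x : ℝ => x)
      (Measure.map (fun x => x + Real.log (∑ v, Real.exp (c v))) ν) :=
    (integrable_map_measure (by fun_prop) hm'.aemeasurable).2 (hi.add (integrable_const _))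
  refine ⟨?_, ?_⟩
  · rw [← hlaw'] at hi'
    exact hi'.comp_measurable hm
  · have h1 := integral_map (μ := μ) hm.aemeasurable (f := fun x : ℝ => x) (by fun_prop)
    have h2 := integral_map (μ := ν) hm'.aemeasurable (f := fun x : ℝ => x) (by fun_prop)
    rw [← h1, hlaw', h2, integral_add hi (integrable_const _)]
    simp

variable [IsProbabilityMeasure μ] {q : (V → ℝ) → V → ℝ}

lemma integrable_rule (hG : Measurable G) (hq : Measurable q) (hqs : ∀ g, q g ∈ simplex V)
    (u : V) : Integrable (fun ω => q (G ω) u) μ := by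
  refine Integrable.of_bound (C := 1)
    ((measurable_pi_apply u).comp (hq.comp hG)).aestronglyMeasurable (Filter.Eventually.of_forall fun ω => ?_)
  rw [Real.norm_of_nonneg ((hqs _).1 u)]
  exact le_one_of_mem_simplex (hqs _) u

lemma integrable_coord_mul_rule (hG : Measurable G)
    (hcdf : ∀ x : ℝ, ν (Set.Iic x) = ENNReal.ofReal (Real.exp (-Real.exp (-x))))
    (hlaw : Measure.map G μ = Measure.pi (fun _ : V => ν))
    (hq : Measurable q) (hqs : ∀ g, q g ∈ simplex V) (u : V) :
    Integrable (fun ω => G ω u * q (G ω) u) μ := by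
  refine (integrable_coord_of_gumbel hG hcdf hlaw u).mul_bdd (c := 1)
    (integrable_rule hG hq hqs u).aestronglyMeasurable
    (Filter.Eventually.of_forall fun ω => ?_)
  rw [Real.norm_of_nonneg ((hqs _).1 u)]
  exact le_one_of_mem_simplex (hqs _) u

lemma integral_rule_mem_simplex (hG : Measurable G) (hq : Measurable q)
    (hqs : ∀ g, q g ∈ simplex V) : (fun u => ∫ ω, q (G ω) u ∂μ) ∈ simplex V := by
  refine ⟨fun u => integral_nonneg fun ω => (hqs _).1 u, ?_⟩
  rw [← integral_finsetSum _ fun u _ => integrable_rule hG hq hqs u]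
  simp [(hqs _).2]

lemma integral_sum_add_mul_rule (hG : Measurable G)
    (hcdf : ∀ x : ℝ, ν (Set.Iic x) = ENNReal.ofReal (Real.exp (-Real.exp (-x))))
    (hlaw : Measure.map G μ = Measure.pi (fun _ : V => ν))
    (hq : Measurable q) (hqs : ∀ g, q g ∈ simplex V) (c : V → ℝ) :
    Integrable (fun ω => ∑ u, (G ω u + c u) * q (G ω) u) μ ∧
    ∫ ω, ∑ u, (G ω u + c u) * q (G ω) u ∂μ =
      ∫ ω, ∑ u, G ω u * q (G ω) u ∂μ + ∑ u, c u * ∫ ω, q (G ω) u ∂μ := by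
  have h1 := fun u => integrable_coord_mul_rule hG hcdf hlaw hq hqs u
  have h2 := fun u => (integrable_rule (μ := μ) hG hq hqs u).const_mul (c u)
  simp_rw [add_mul, sum_add_distrib]
  refine ⟨(integrable_finsetSum _ fun u _ => h1 u).add (integrable_finsetSum _ fun u _ => h2 u), ?_⟩
  rw [integral_add (integrable_finsetSum _ fun u _ => h1 u)
    (integrable_finsetSum _ fun u _ => h2 u), integral_finsetSum _ fun u _ => h2 u]
  simp_rw [integral_const_mul]

lemma integral_rule_add_le [Nonempty V] (hG : Measurable G)
    (hcdf : ∀ x : ℝ, ν (Set.Iic x) = ENNReal.ofReal (Real.exp (-Real.exp (-x))))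
    (hlaw : Measure.map G μ = Measure.pi (fun _ : V => ν))
    (hq : Measurable q) (hqs : ∀ g, q g ∈ simplex V) (c : V → ℝ) :
    ∫ ω, ∑ u, G ω u * q (G ω) u ∂μ + ∑ u, c u * ∫ ω, q (G ω) u ∂μ ≤
      ∫ x, x ∂ν + Real.log (∑ v, Real.exp (c v)) := by
  obtain ⟨h1, h2⟩ := integral_sum_add_mul_rule hG hcdf hlaw hq hqs c
  obtain ⟨h3, h4⟩ := integral_sup'_of_gumbel hG hcdf hlaw c
  rw [← h2, ← h4]
  exact integral_mono h1 h3 fun ω => sum_mul_le_sup' (hqs _) _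

lemma integral_qArgmax_add_eq [Nonempty V] (hG : Measurable G)
    (hcdf : ∀ x : ℝ, ν (Set.Iic x) = ENNReal.ofReal (Real.exp (-Real.exp (-x))))
    (hlaw : Measure.map G μ = Measure.pi (fun _ : V => ν)) (p : V → ℝ) (α : ℝ) :
    ∫ ω, ∑ u, G ω u * qArgmax p α (G ω) u ∂μ +
        ∑ u, α * Real.log (p u) * ∫ ω, qArgmax p α (G ω) u ∂μ =
      ∫ x, x ∂ν + Real.log (∑ v, Real.exp (α * Real.log (p v))) := by
  rw [← (integral_sum_add_mul_rule hG hcdf hlaw (measurable_qArgmax p α)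
    (qArgmax_mem_simplex p α) fun u => α * Real.log (p u)).2,
    ← (integral_sup'_of_gumbel hG hcdf hlaw fun u => α * Real.log (p u)).2]
  simp_rw [sum_add_mul_qArgmax]

/-- The Gumbel-max trick. -/
lemma integral_qArgmax_eq_softmax [Nonempty V] (hG : Measurable G)
    (hcdf : ∀ x : ℝ, ν (Set.Iic x) = ENNReal.ofReal (Real.exp (-Real.exp (-x))))
    (hlaw : Measure.map G μ = Measure.pi (fun _ : V => ν)) (p : V → ℝ) (α : ℝ) :
    (fun u => ∫ ω, qArgmax p α (G ω) u ∂μ) = softmax fun u => α * Real.log (p u) := by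
  refine eq_softmax_of_forall_le fun c => ?_
  have h1 := integral_qArgmax_add_eq hG hcdf hlaw p α
  have h2 := integral_rule_add_le hG hcdf hlaw (measurable_qArgmax p α)
    (qArgmax_mem_simplex p α) c
  linarith

/-- The value of a sampling rule is at most the Gumbel mean plus the entropy of its output. -/
lemma integral_rule_le_entropy [Nonempty V] (hG : Measurable G)
    (hcdf : ∀ x : ℝ, ν (Set.Iic x) = ENNReal.ofReal (Real.exp (-Real.exp (-x))))
    (hlaw : Measure.map G μ = Measure.pi (fun _ : V => ν))
    (hq : Measurable q) (hqs : ∀ g, q g ∈ simplex V) :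
    ∫ ω, ∑ u, G ω u * q (G ω) u ∂μ ≤
      ∫ x, x ∂ν - ∑ u, (∫ ω, q (G ω) u ∂μ) * Real.log (∫ ω, q (G ω) u ∂μ) := by
  have hms := integral_rule_mem_simplex (μ := μ) hG hq hqs
  set m : V → ℝ := fun u => ∫ ω, q (G ω) u ∂μ with hm
  refine le_of_forall_pos_le_add fun η hη => ?_
  have hn : (0 : ℝ) < Fintype.card V := by exact_mod_cast Fintype.card_pos
  obtain ⟨δ, hδ, hδη⟩ : ∃ δ : ℝ, 0 < δ ∧ Fintype.card V * δ = η :=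
    ⟨η / Fintype.card V, by positivity, by field_simp⟩
  have hpos : ∀ u, 0 < m u + δ := fun u => by linarith [hms.1 u]
  have h1 := integral_rule_add_le hG hcdf hlaw hq hqs fun u => Real.log (m u + δ)
  have h2 : ∑ v, Real.exp (Real.log (m v + δ)) = 1 + η := by
    simp_rw [fun v => Real.exp_log (hpos v), sum_add_distrib, hms.2]
    simp [hδη]
  rw [h2] at h1
  have h3 : Real.log (1 + η) ≤ η := by
    linarith [Real.log_le_sub_one_of_pos (by linarith : 0 < 1 + η)]
  have h4 : ∑ u, m u * Real.log (m u) ≤ ∑ u, Real.log (m u + δ) * m u := by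
    refine sum_le_sum fun u _ => ?_
    rcases (hms.1 u).eq_or_lt with h | h
    · rw [← h]; simp
    · rw [mul_comm]
      exact mul_le_mul_of_nonneg_right (Real.log_le_log h (by linarith)) h.le
  change _ ≤ _ - ∑ u, m u * Real.log (m u) + η
  change _ + ∑ u, Real.log (m u + δ) * m u ≤ _ at h1
  linarith

end Gumbel

/-- The tempered distributions `∝ p ^ α` maximize entropy in the KL ball around `p` whose
boundary they lie on. -/
lemma sum_mul_log_softmax_le {V : Type*} [Fintype V] [Nonempty V] {m p : V → ℝ} {α : ℝ}
    (hm : m ∈ simplex V) (hp : p ∈ simplex V) (hppos : ∀ u, 0 < p u) (h0 : 0 ≤ α) (h1 : α ≤ 1)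
    (h : KL m p ≤ KL (softmax fun u => α * Real.log (p u)) p) :
    ∑ u, softmax (fun u => α * Real.log (p u)) u *
        Real.log (softmax (fun u => α * Real.log (p u)) u) ≤ ∑ u, m u * Real.log (m u) := by
  rcases h1.eq_or_lt with rfl | h1
  · simp_rw [one_mul, softmax_log hp hppos] at h ⊢
    rw [KL_eq_sub p hppos, sub_self] at h
    rw [eq_of_KL_nonpos hm hp hppos h]
  · set c : V → ℝ := fun u => α * Real.log (p u) with hc
    have hr := softmax_mem_simplex c
    have hlin : ∀ q : V → ℝ, ∑ u, c u * q u = α * ∑ u, q u * Real.log (p u) := fun q => by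
      rw [mul_sum]
      exact sum_congr rfl fun u _ => by rw [hc]; ring
    have hg := KL_nonneg hm hr (softmax_pos c)
    rw [KL_eq_sub m (softmax_pos c), sum_mul_log_softmax hm, hlin] at hg
    have hs := sum_mul_log_softmax hr c
    rw [hlin] at hs
    rw [KL_eq_sub m hppos, KL_eq_sub _ hppos] at h
    nlinarith [mul_le_mul_of_nonneg_left h h0]

lemma continuous_KL_softmax {V : Type*} [Fintype V] [Nonempty V] {p : V → ℝ}
    (hppos : ∀ u, 0 < p u) :
    Continuous fun α : ℝ => KL (softmax fun u => α * Real.log (p u)) p := by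
  have hs : ∀ u, Continuous fun α : ℝ => softmax (fun u => α * Real.log (p u)) u := fun u =>
    Continuous.div (by fun_prop) (by fun_prop) fun α => (sum_exp_pos _).ne'
  simp_rw [KL_eq_sub _ hppos]
  refine Continuous.sub (continuous_finsetSum _ fun u _ => (hs u).mul ?_)
    (continuous_finsetSum _ fun u _ => (hs u).mul continuous_const)
  exact (hs u).log fun α => (softmax_pos _ u).ne'


theorem stmt_9 {V : Type*} [Fintype V] [Nonempty V]
    {Ω : Type*} [MeasurableSpace Ω] (μ : Measure Ω) [IsProbabilityMeasure μ]
    (G : Ω → V → ℝ) (hG : Measurable G)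
    (ν : Measure ℝ) [IsProbabilityMeasure ν]
    -- `ν` is the standard Gumbel law: CDF `F(x) = exp (−exp (−x))`
    (hcdf : ∀ x : ℝ, ν (Set.Iic x) = ENNReal.ofReal (Real.exp (-Real.exp (-x))))
    -- the coordinates of `G` are i.i.d. with law `ν`
    (hlaw : Measure.map G μ = Measure.pi (fun _ : V => ν))
    (p : V → ℝ) (hp : p ∈ simplex V) (hppos : ∀ u, 0 < p u)
    (ε : ℝ) (hε : 0 ≤ ε) :
    ∃ α ∈ Set.Icc (0 : ℝ) 1,
      -- `q*` is feasible: measurable, simplex-valued, and satisfies the soft KL constraint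
      Measurable (qArgmax p α) ∧
      (∀ g, qArgmax p α g ∈ simplex V) ∧
      KL (fun u => ∫ ω, qArgmax p α (G ω) u ∂μ) p ≤ ε ∧
      -- `q*` is optimal among all feasible sampling rules
      (∀ q : (V → ℝ) → V → ℝ, Measurable q → (∀ g, q g ∈ simplex V) →
        KL (fun u => ∫ ω, q (G ω) u ∂μ) p ≤ ε →
        ∫ ω, ∑ u, G ω u * q (G ω) u ∂μ ≤
          ∫ ω, ∑ u, G ω u * qArgmax p α (G ω) u ∂μ) ∧
      -- `α` saturates the KL constraint if possible, else `α = 0`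
      (KL (fun u => ∫ ω, qArgmax p α (G ω) u ∂μ) p = ε ∨ α = 0) := by
  have hmean := integral_qArgmax_eq_softmax hG hcdf hlaw p
  set φ : ℝ → ℝ := fun α => KL (softmax fun u => α * Real.log (p u)) p with hφ
  have hφ1 : φ 1 = 0 := by
    simp_rw [hφ, one_mul, softmax_log hp hppos, KL_eq_sub p hppos, sub_self]
  obtain ⟨α, hα, hcase⟩ : ∃ α ∈ Set.Icc (0 : ℝ) 1, φ α = ε ∨ (φ α ≤ ε ∧ α = 0) := by
    rcases le_total (φ 0) ε with h | h
    · exact ⟨0, by simp, Or.inr ⟨h, rfl⟩⟩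
    · obtain ⟨α, hα, hαε⟩ := intermediate_value_Icc' zero_le_one
        (continuous_KL_softmax hppos).continuousOn (show ε ∈ Set.Icc (φ 1) (φ 0) from
          ⟨hφ1.trans_le hε, h⟩)
      exact ⟨α, hα, Or.inl hαε⟩
  refine ⟨α, hα, measurable_qArgmax p α, qArgmax_mem_simplex p α, ?_, fun q hq hqs hKL => ?_, ?_⟩
  · rw [hmean]
    exact hcase.elim le_of_eq And.left
  · have hval := integral_qArgmax_add_eq hG hcdf hlaw p α
    rcases hcase with hε | ⟨-, rfl⟩
    · have hs := sum_mul_log_softmax (softmax_mem_simplex fun u => α * Real.log (p u))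
        fun u => α * Real.log (p u)
      have hle := sum_mul_log_softmax_le (integral_rule_mem_simplex hG hq hqs) hp hppos hα.1 hα.2
        (hKL.trans hε.ge)
      have hent := integral_rule_le_entropy hG hcdf hlaw hq hqs
      simp_rw [fun u => congrFun (hmean α) u] at hval
      linarith
    · have hle := integral_rule_add_le hG hcdf hlaw hq hqs fun _ => 0
      simp only [zero_mul, sum_const_zero, add_zero] at hval hle
      linarith
  · rw [hmean]
    exact hcase.imp id And.right
end

section
/- Let Σ be a nonempty finite set and let G = (G_u)_{u∈Σ} be a random vector whose coordinates are i.i.d. from an atomless (continuous) probability law on ℝ with finite first moment. Then for every measurable function q : ℝ^Σ → Δ(Σ) there exists a measurable function f : ℝ^Σ → Σ such that E[G_{f(G)}] = E[Σ_{u∈Σ} G_u q(G)_u] and P(f(G) = u) = E[q(G)_u] for every u ∈ Σ. Consequently, for any function D : Δ(Σ) × Δ(Σ) → ℝ, any p ∈ Δ(Σ), and any ε ≥ 0, if the problem of maximizing E[Σ_u G_u q(G)_u] over measurable q : ℝ^Σ → Δ(Σ) subject to D(E[q(G)], p) ≤ ε admits an optimal solution, then it admits an optimal solution q' such that q'(g)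 is a Dirac point mass (support of size 1) for almost every g. -/
open Finset MeasureTheory

theorem Convex.extremePoints_nonempty_of_isClosed_of_isBounded {H : Type*}
    [NormedAddCommGroup H] [InnerProductSpace ℝ H] [CompleteSpace H] {S : Set H}
    (hconv : Convex ℝ S) (hclosed : IsClosed S) (hbdd : Bornology.IsBounded S)
    (hne : S.Nonempty) : (S.extremePoints ℝ).Nonempty := by
  let e : H ≃ₗ[ℝ] WeakDual ℝ H :=
    (InnerProductSpace.toDual ℝ H).toLinearEquiv.trans StrongDual.toWeakDual
  have he : ∀ x y : H, e x y = inner ℝ x y := fun x y => rfl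
  have hK : IsClosed (e '' S) := by
    rw [← isOpen_compl_iff, isOpen_iff_forall_mem_open]
    intro φ hφ
    obtain ⟨x, rfl⟩ := e.surjective φ
    have hx : x ∉ S := fun h => hφ ⟨x, h, rfl⟩
    obtain ⟨l, c, hl, hlx⟩ := geometric_hahn_banach_closed_point hconv hclosed hx
    obtain ⟨y, rfl⟩ := (InnerProductSpace.toDual ℝ H).surjective l
    refine ⟨{ψ : WeakDual ℝ H | c < ψ y}, ?_, ?_, ?_⟩
    · rintro _ hψ ⟨a, ha, rfl⟩
      have := hl a ha
      simp only [Set.mem_ofPred_eq, he, InnerProductSpace.toDual_apply_apply] at hψ this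
      rw [real_inner_comm] at hψ
      exact lt_asymm hψ this
    · exact isOpen_lt continuous_const (WeakDual.eval_continuous y)
    · simp only [Set.mem_ofPred_eq, he, InnerProductSpace.toDual_apply_apply] at hlx ⊢
      rwa [real_inner_comm]
  obtain ⟨R, hR⟩ := hbdd.subset_closedBall 0
  have hcomp : IsCompact (e '' S) := by
    refine (WeakDual.isCompact_closedBall (𝕜 := ℝ) (E := H) 0 R).of_isClosed_subset hK ?_
    rintro _ ⟨x, hx, rfl⟩
    have := hR hx
    rw [mem_closedBall_zero_iff] at this
    simpa [e] using this
  have : LocallyConvexSpace ℝ (WeakDual ℝ H) := WeakBilin.locallyConvexSpace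
  obtain ⟨_, hφ⟩ := hcomp.extremePoints_nonempty (hne.image e)
  rw [← image_extremePoints] at hφ
  obtain ⟨x, hx, -⟩ := hφ
  exact ⟨x, hx⟩

theorem exists_subset_measure_ne_zero_diff_ne_zero {X : Type*} [TopologicalSpace X] [T2Space X]
    [SecondCountableTopology X] [MeasurableSpace X] [OpensMeasurableSpace X] {m : Measure X}
    [NullSingletonClass m] {B : Set X} (hB : MeasurableSet B) (hmB : m B ≠ 0) :
    ∃ A ⊆ B, MeasurableSet A ∧ m A ≠ 0 ∧ m (B \ A) ≠ 0 := by
  have hne : Nonempty X := by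
    by_contra h
    rw [not_nonempty_iff] at h
    exact hmB (by simp [Set.eq_empty_of_isEmpty B])
  have hfreq : ∀ b : X, ∃ᵐ x ∂(m.restrict B), id x ≠ b := by
    intro b hb
    have h : (m.restrict B) {b}ᶜ = 0 := by
      simpa only [id, not_not, ae_iff, ← Set.compl_singleton_eq] using hb
    rw [Measure.restrict_apply (measurableSet_singleton b).compl] at h
    apply hmB
    refine measure_mono_null (t := ({b}ᶜ ∩ B) ∪ {b}) ?_ (measure_union_null h (measure_singleton b))
    intro x hx
    by_cases hxb : x = b <;> simp [hxb, hx]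
  obtain ⟨a, b, hab, ha, hb⟩ :=
    exists_ne_forall_mem_nhds_pos_measure_preimage hfreq
  obtain ⟨U, W, hU, hW, haU, hbW, hUW⟩ := t2_separation hab
  have hUpos := ha U (hU.mem_nhds haU)
  have hWpos := hb W (hW.mem_nhds hbW)
  rw [Set.preimage_id, Measure.restrict_apply hU.measurableSet] at hUpos
  rw [Set.preimage_id, Measure.restrict_apply hW.measurableSet] at hWpos
  refine ⟨U ∩ B, Set.inter_subset_right, hU.measurableSet.inter hB, hUpos.ne', ?_⟩
  refine (hWpos.trans_le (measure_mono ?_)).ne'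
  rintro x ⟨hxW, hxB⟩
  exact ⟨hxB, fun h => Set.disjoint_left.mp hUW h.1 hxW⟩

theorem exists_pairwise_disjoint_subsets_measure_ne_zero {X : Type*} [TopologicalSpace X]
    [T2Space X] [SecondCountableTopology X] [MeasurableSpace X] [OpensMeasurableSpace X]
    {m : Measure X} [NullSingletonClass m] (n : ℕ) {B : Set X} (hB : MeasurableSet B)
    (hmB : m B ≠ 0) :
    ∃ A : Fin n → Set X, (∀ i, A i ⊆ B) ∧ (∀ i, MeasurableSet (A i)) ∧ (∀ i, m (A i) ≠ 0) ∧
      Pairwise (Function.onFun Disjoint A) := by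
  induction n generalizing B with
  | zero => exact ⟨fun _ => ∅, fun i => i.elim0, fun i => i.elim0, fun i => i.elim0,
      fun i => i.elim0⟩
  | succ n ih =>
    obtain ⟨C, hCB, hC, hmC, hmBC⟩ := exists_subset_measure_ne_zero_diff_ne_zero hB hmB
    obtain ⟨A, hAB, hA, hmA, hdisj⟩ := ih (hB.diff hC) hmBC
    have hCA : ∀ i, Disjoint C (A i) := fun i => Set.disjoint_sdiff_right.mono_right (hAB i)
    refine ⟨Fin.cons C A, ?_, ?_, ?_, ?_⟩
    · exact Fin.cases hCB fun i => (hAB i).trans Set.sdiff_subset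
    · exact Fin.cases hC hA
    · exact Fin.cases hmC hmA
    · intro i j hij
      induction i using Fin.cases with
      | zero =>
        induction j using Fin.cases with
        | zero => exact absurd rfl hij
        | succ j => exact hCA j
      | succ i =>
        induction j using Fin.cases with
        | zero => exact (hCA i).symm
        | succ j => exact hdisj fun h => hij (congrArg Fin.succ h)

/-- The square-integrable fields with values in the standard simplex whose inner products with the
fields `Ψ j` are `c j`. -/
def simplexFields {V J X : Type*} [Fintype V] [MeasurableSpace X] {m : Measure X}
    (Ψ : J → Lp (EuclideanSpace ℝ V) 2 m) (c : J → ℝ) : Set (Lp (EuclideanSpace ℝ V) 2 m) :=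
  {F | (∀ᵐ x ∂m, (F x).ofLp ∈ stdSimplex ℝ V) ∧ ∀ j, inner ℝ (Ψ j) F = c j}

section simplexFields

variable {V J X : Type*} [Fintype V] [MeasurableSpace X] {m : Measure X}
  {Ψ : J → Lp (EuclideanSpace ℝ V) 2 m} {c : J → ℝ}

theorem exists_norm_toLp_le_of_mem_stdSimplex (V : Type*) [Fintype V] :
    ∃ C, 0 ≤ C ∧ ∀ x ∈ stdSimplex ℝ V, ‖WithLp.toLp 2 x‖ ≤ C := by
  obtain ⟨C, hC⟩ := (isCompact_stdSimplex ℝ V).exists_bound_of_continuousOn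
    (f := WithLp.toLp 2) (PiLp.continuous_toLp 2 _).continuousOn
  exact ⟨max C 0, le_max_right _ _, fun x hx => (hC x hx).trans (le_max_left _ _)⟩

theorem convex_simplexFields : Convex ℝ (simplexFields Ψ c) := by
  rintro F ⟨hF, hFc⟩ F' ⟨hF', hFc'⟩ a b ha hb hab
  refine ⟨?_, fun j => ?_⟩
  · filter_upwards [hF, hF', Lp.coeFn_add (a • F) (b • F'), Lp.coeFn_smul a F,
      Lp.coeFn_smul b F'] with x h h' hadd hsa hsb
    rw [hadd, Pi.add_apply, hsa, hsb]
    exact convex_stdSimplex ℝ V h h' ha hb hab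
  · rw [inner_add_right, inner_smul_right, inner_smul_right, hFc, hFc', ← add_mul, hab, one_mul]

theorem isClosed_simplexFields : IsClosed (simplexFields Ψ c) := by
  refine IsClosed.and ?_ ?_
  · refine IsSeqClosed.isClosed fun F F₀ hF hlim => ?_
    obtain ⟨φ, -, hφ⟩ := (tendstoInMeasure_of_tendsto_Lp hlim).exists_seq_tendsto_ae
    filter_upwards [hφ, ae_all_iff.2 fun n => hF n] with x hx hmem
    exact (isClosed_stdSimplex ℝ V).mem_of_tendsto
      (((PiLp.continuous_ofLp 2 _).tendsto _).comp hx) (.of_forall fun n => hmem (φ n))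
  · simp only [Set.ofPred_forall]
    exact isClosed_iInter fun j => isClosed_eq (by fun_prop) continuous_const

theorem isBounded_simplexFields [IsFiniteMeasure m] :
    Bornology.IsBounded (simplexFields Ψ c) := by
  obtain ⟨C, hC0, hC⟩ := exists_norm_toLp_le_of_mem_stdSimplex V
  refine isBounded_iff_forall_norm_le.2 ⟨_, fun F hF => Lp.norm_le_of_ae_bound hC0 ?_⟩
  filter_upwards [hF.1] with x hx using hC _ hx

end simplexFields

theorem ae_finset_sum_smul_indicatorConstLp {ι E X : Type*} [NormedAddCommGroup E]
    [NormedSpace ℝ E] [MeasurableSpace X] {m : Measure X} [IsFiniteMeasure m] (t : Finset ι)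
    (r : ι → ℝ) {A : ι → Set X} (hA : ∀ i, MeasurableSet (A i)) (w : E) :
    ⇑(∑ i ∈ t, r i • indicatorConstLp 2 (hA i) (measure_ne_top m _) w) =ᵐ[m]
      fun x => (∑ i ∈ t, r i * (A i).indicator 1 x) • w := by
  classical
  induction t using Finset.induction_on with
  | empty =>
    filter_upwards [Lp.coeFn_zero E 2 m] with x hx
    simpa using hx
  | insert i t hi ih =>
    rw [Finset.sum_insert hi]
    filter_upwards [ih, Lp.coeFn_add (r i • indicatorConstLp 2 (hA i) (measure_ne_top m _) w)
        (∑ i ∈ t, r i • indicatorConstLp 2 (hA i) (measure_ne_top m _) w),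
      Lp.coeFn_smul (r i) (indicatorConstLp 2 (hA i) (measure_ne_top m _) w),
      indicatorConstLp_coeFn (p := 2) (hs := hA i) (hμs := measure_ne_top m _) (c := w)]
      with x hsum hadd hsmul hind
    rw [hadd, Pi.add_apply, hsum, hsmul, Pi.smul_apply, hind, Finset.sum_insert hi, add_smul,
      mul_smul]
    by_cases hx : x ∈ A i <;> simp [hx]

theorem add_smul_single_sub_single_mem_stdSimplex {V : Type*} [Fintype V] [DecidableEq V]
    {y : EuclideanSpace ℝ V} (hy : y.ofLp ∈ stdSimplex ℝ V) {u v : V} (huv : u ≠ v) {a : ℝ}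
    (hu : |a| ≤ y u) (hv : |a| ≤ y v) :
    (y + a • (EuclideanSpace.single u (1 : ℝ) - EuclideanSpace.single v 1)).ofLp ∈
      stdSimplex ℝ V := by
  refine ⟨fun i => ?_, ?_⟩
  · have := hy.1 i
    have := abs_le.1 hu
    have := abs_le.1 hv
    simp only [PiLp.add_apply, PiLp.smul_apply, PiLp.sub_apply, PiLp.single_apply, smul_eq_mul]
    split_ifs with h1 h2 h2
    · exact absurd (h1.symm.trans h2) huv
    · subst h1; linarith
    · subst h2; linarith
    · linarith
  · simp [Finset.sum_add_distrib, ← Finset.mul_sum, hy.2]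

theorem eq_zero_of_mem_extremePoints_of_add_sub_mem {E : Type*} [AddCommGroup E] [Module ℝ E]
    {S : Set E} {x h : E} (hx : x ∈ S.extremePoints ℝ) (hadd : x + h ∈ S) (hsub : x - h ∈ S) :
    h = 0 := by
  have := hx.2 hadd hsub
    ⟨1 / 2, 1 / 2, by norm_num, by norm_num, by norm_num, by
      rw [← smul_add, add_add_sub_cancel, ← two_smul ℝ x, smul_smul]; norm_num⟩
  simpa using this

section extremePoints

variable {V J X : Type*} [Fintype V] [Finite J] [TopologicalSpace X] [T2Space X]
  [SecondCountableTopology X] [MeasurableSpace X] [OpensMeasurableSpace X] {m : Measure X}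
  [IsFiniteMeasure m] [NullSingletonClass m] {Ψ : J → Lp (EuclideanSpace ℝ V) 2 m} {c : J → ℝ}
  {F : Lp (EuclideanSpace ℝ V) 2 m}

theorem measure_le_and_le_eq_zero_of_mem_extremePoints
    (hF : F ∈ (simplexFields Ψ c).extremePoints ℝ) {u v : V} (huv : u ≠ v) {ε : ℝ} (hε : 0 < ε) :
    m {x | ε ≤ F x u ∧ ε ≤ F x v} = 0 := by
  classical
  have := Fintype.ofFinite J
  by_contra hpos
  have hmeas : ∀ i, Measurable fun x => F x i := fun i =>
    (EuclideanSpace.proj (𝕜 := ℝ) i).measurable.comp (Lp.stronglyMeasurable F).measurable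
  have hB : MeasurableSet {x | ε ≤ F x u ∧ ε ≤ F x v} :=
    (measurableSet_le measurable_const (hmeas u)).inter
      (measurableSet_le measurable_const (hmeas v))
  obtain ⟨A, hAB, hA, hmA, hdisj⟩ :=
    exists_pairwise_disjoint_subsets_measure_ne_zero (Fintype.card J + 1) hB hpos
  let w : EuclideanSpace ℝ V := EuclideanSpace.single u 1 - EuclideanSpace.single v 1
  let T : (Fin (Fintype.card J + 1) → ℝ) →ₗ[ℝ] Lp (EuclideanSpace ℝ V) 2 m :=
    Fintype.linearCombination ℝ fun i => indicatorConstLp 2 (hA i) (measure_ne_top m _) w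
  let L : (Fin (Fintype.card J + 1) → ℝ) →ₗ[ℝ] (J → ℝ) :=
    LinearMap.pi fun j => innerₛₗ ℝ (Ψ j) ∘ₗ T
  have hT : ∀ r, ⇑(T r) =ᵐ[m] fun x => (∑ i, r i * (A i).indicator 1 x) • w := fun r =>
    ae_finset_sum_smul_indicatorConstLp Finset.univ r hA w
  obtain ⟨s, hsL, hs⟩ := Submodule.exists_mem_ne_zero_of_ne_bot
    (LinearMap.ker_ne_bot_of_finrank_lt (f := L) (by simp))
  obtain ⟨i₀, hi₀⟩ := Function.ne_iff.1 hs
  have hsum : 0 < ∑ i, |s i| :=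
    Finset.sum_pos' (fun i _ => abs_nonneg _) ⟨i₀, Finset.mem_univ _, abs_pos.2 hi₀⟩
  set δ := ε / ∑ i, |s i| with hδ
  have hδ0 : 0 < δ := div_pos hε hsum
  have hbound : ∀ r : Fin (Fintype.card J + 1) → ℝ, (∀ i, |r i| = δ * |s i|) → ∀ x,
      |∑ i, r i * (A i).indicator (1 : X → ℝ) x| ≤ ε := by
    intro r hr x
    calc |∑ i, r i * (A i).indicator (1 : X → ℝ) x|
        ≤ ∑ i, |r i * (A i).indicator (1 : X → ℝ) x| := Finset.abs_sum_le_sum_abs _ _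
      _ ≤ ∑ i, δ * |s i| := by
        refine Finset.sum_le_sum fun i _ => ?_
        rw [abs_mul, hr]
        refine mul_le_of_le_one_right (by positivity) ?_
        by_cases hx : x ∈ A i <;> simp [hx]
      _ = ε := by rw [← Finset.mul_sum, hδ, div_mul_cancel₀ _ hsum.ne']
  have hmem : ∀ r, r ∈ LinearMap.ker L → (∀ i, |r i| = δ * |s i|) →
      F + T r ∈ simplexFields Ψ c := by
    intro r hrL hr
    refine ⟨?_, fun j => ?_⟩
    · filter_upwards [hF.1.1, Lp.coeFn_add F (T r), hT r] with x hx hadd hTx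
      rw [hadd, Pi.add_apply, hTx]
      refine add_smul_single_sub_single_mem_stdSimplex hx huv ?_ ?_
      all_goals
        by_cases hxB : x ∈ {x | ε ≤ F x u ∧ ε ≤ F x v}
        · first
          | exact (hbound r hr x).trans hxB.1
          | exact (hbound r hr x).trans hxB.2
        · have : ∑ i, r i * (A i).indicator (1 : X → ℝ) x = 0 :=
            Finset.sum_eq_zero fun i _ => by
              rw [Set.indicator_of_notMem fun h => hxB (hAB i h), mul_zero]
          rw [this, abs_zero]
          exact hx.1 _
    · have : inner ℝ (Ψ j) (T r) = 0 := congrFun (LinearMap.mem_ker.1 hrL) j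
      rw [inner_add_right, hF.1.2 j, this, add_zero]
  have hzero : T (δ • s) = 0 := by
    refine eq_zero_of_mem_extremePoints_of_add_sub_mem hF
      (hmem _ (Submodule.smul_mem _ _ hsL) fun i => ?_) ?_
    · simp [abs_mul, abs_of_pos hδ0]
    · rw [sub_eq_add_neg, ← map_neg]
      refine hmem _ (Submodule.neg_mem _ (Submodule.smul_mem _ _ hsL)) fun i => ?_
      simp [abs_mul, abs_of_pos hδ0]
  apply hmA i₀
  have hae : ∀ᵐ x ∂m, x ∉ A i₀ := by
    have h := hT (δ • s)
    rw [hzero] at h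
    filter_upwards [h, Lp.coeFn_zero (EuclideanSpace ℝ V) 2 m] with x hx h0 hxA
    rw [h0, Finset.sum_eq_single_of_mem i₀ (Finset.mem_univ _), Set.indicator_of_mem hxA] at hx
    · have hxu := congrArg (fun y : EuclideanSpace ℝ V => y u) hx
      simp [w, huv, hδ0.ne'] at hxu
      exact hi₀ hxu
    · intro i _ hi
      rw [Set.indicator_of_notMem fun h => Set.disjoint_left.1 (hdisj hi) h hxA, mul_zero]
  simpa [ae_iff] using hae

theorem ae_exists_eq_one_of_mem_extremePoints
    (hF : F ∈ (simplexFields Ψ c).extremePoints ℝ) : ∀ᵐ x ∂m, ∃ u, F x u = 1 := by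
  have hnull : ∀ᵐ x ∂m, ∀ p : {p : V × V // p.1 ≠ p.2}, ∀ n : ℕ,
      ¬ (1 / ((n : ℝ) + 1) ≤ F x p.1.1 ∧ 1 / ((n : ℝ) + 1) ≤ F x p.1.2) := by
    refine ae_all_iff.2 fun p => ae_all_iff.2 fun n => ?_
    rw [ae_iff]
    simpa only [not_not] using
      measure_le_and_le_eq_zero_of_mem_extremePoints hF p.2 (by positivity)
  filter_upwards [hF.1.1, hnull] with x hx hpair
  obtain ⟨u, -, hu⟩ : ∃ u ∈ Finset.univ, 0 < F x u := by
    by_contra! h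
    have := Finset.sum_nonpos h
    rw [hx.2] at this
    norm_num at this
  refine ⟨u, ?_⟩
  rw [← hx.2]
  refine (Finset.sum_eq_single_of_mem u (Finset.mem_univ _) fun v _ hvu => ?_).symm
  by_contra hv
  have hv : 0 < F x v := lt_of_le_of_ne (hx.1 v) (Ne.symm hv)
  obtain ⟨n, hn⟩ := exists_nat_one_div_lt (lt_min hu hv)
  exact hpair ⟨(u, v), hvu.symm⟩ n ⟨(hn.trans_le (min_le_left _ _)).le,
    (hn.trans_le (min_le_right _ _)).le⟩

end extremePoints

theorem exists_measurable_selection_of_ae_exists {X V : Type*} [Finite V] [Nonempty V]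
    [MeasurableSpace X] {m : Measure X} {P : V → X → Prop}
    (hP : ∀ u, MeasurableSet {x | P u x}) (h : ∀ᵐ x ∂m, ∃ u, P u x) :
    ∃ f : X → V, (∀ u, MeasurableSet {x | f x = u}) ∧ ∀ᵐ x ∂m, P (f x) x := by
  classical
  let _ : MeasurableSpace V := ⊤
  let choice : (V → Prop) → V := fun R => Classical.epsilon R
  have hmeas : Measurable fun x => choice fun u => P u x :=
    (Measurable.of_discrete (f := choice)).comp
      (measurable_pi_lambda _ fun u => measurableSet_setOfPred.1 (hP u))
  exact ⟨_, fun u => hmeas (measurableSet_singleton u), h.mono fun x hx => Classical.epsilon_spec hx⟩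

section purification

variable {V J X : Type*} [Fintype V] [Nonempty V] [Finite J] [TopologicalSpace X] [T2Space X]
  [SecondCountableTopology X] [MeasurableSpace X] [OpensMeasurableSpace X] {m : Measure X}
  [IsFiniteMeasure m] [NullSingletonClass m] {ψ : J → V → X → ℝ} {q : X → V → ℝ}

theorem exists_purification_of_memLp_two (hψ : ∀ j u, MemLp (ψ j u) 2 m) (hq : Measurable q)
    (hqs : ∀ x, q x ∈ stdSimplex ℝ V) :
    ∃ f : X → V, (∀ u, MeasurableSet {x | f x = u}) ∧
      ∀ j, ∫ x, ψ j (f x) x ∂m = ∫ x, ∑ u, ψ j u x * q x u ∂m := by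
  classical
  have hψ' : ∀ j, MemLp (fun x => WithLp.toLp 2 fun u => ψ j u x) 2 m := fun j =>
    MemLp.of_eval_piLp fun u => hψ j u
  obtain ⟨C, -, hC⟩ := exists_norm_toLp_le_of_mem_stdSimplex V
  have hq' : MemLp (fun x => WithLp.toLp 2 (q x)) 2 m :=
    .of_bound ((PiLp.continuous_toLp 2 _).measurable.comp hq).aestronglyMeasurable C
      (.of_forall fun x => hC _ (hqs x))
  let Ψ : J → Lp (EuclideanSpace ℝ V) 2 m := fun j => (hψ' j).toLp
  have hinner : ∀ (j : J) (F : Lp (EuclideanSpace ℝ V) 2 m),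
      inner ℝ (Ψ j) F = ∫ x, ∑ u, ψ j u x * F x u ∂m := by
    intro j F
    rw [L2.inner_def]
    refine integral_congr_ae ?_
    filter_upwards [(hψ' j).coeFn_toLp] with x hx
    rw [hx, PiLp.inner_apply]
    exact Finset.sum_congr rfl fun u _ => by simp [mul_comm]
  obtain ⟨F, hF⟩ := convex_simplexFields.extremePoints_nonempty_of_isClosed_of_isBounded
    isClosed_simplexFields isBounded_simplexFields
    (S := simplexFields Ψ fun j => ∫ x, ∑ u, ψ j u x * q x u ∂m) ⟨hq'.toLp, by
      filter_upwards [hq'.coeFn_toLp] with x hx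
      rw [hx]
      exact hqs x, fun j => by
      rw [hinner]
      refine integral_congr_ae ?_
      filter_upwards [hq'.coeFn_toLp] with x hx
      rw [hx]⟩
  have hmeas : ∀ u, MeasurableSet {x | F x u = 1} := fun u =>
    (EuclideanSpace.proj (𝕜 := ℝ) u).measurable.comp (Lp.stronglyMeasurable F).measurable
      (measurableSet_singleton 1)
  obtain ⟨f, hf, hfF⟩ := exists_measurable_selection_of_ae_exists hmeas
    (ae_exists_eq_one_of_mem_extremePoints hF)
  refine ⟨f, hf, fun j => ?_⟩
  refine Eq.trans ?_ (hF.1.2 j)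
  rw [hinner]
  refine integral_congr_ae ?_
  filter_upwards [hF.1.1, hfF] with x hx hfx
  have hzero : ∀ u, u ≠ f x → F x u = 0 := by
    intro u hu
    have hsum := Finset.add_sum_erase Finset.univ (F x).ofLp (Finset.mem_univ (f x))
    rw [hx.2, hfx, add_eq_left, Finset.sum_eq_zero_iff_of_nonneg fun i _ => hx.1 i] at hsum
    exact hsum u (Finset.mem_erase.2 ⟨hu, Finset.mem_univ u⟩)
  rw [Finset.sum_eq_single_of_mem (f x) (Finset.mem_univ _) fun u _ hu => by
    rw [hzero u hu, mul_zero], hfx, mul_one]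

theorem exists_purification_of_integrable (hψ : ∀ j u, Integrable (ψ j u) m) (hq : Measurable q)
    (hqs : ∀ x, q x ∈ stdSimplex ℝ V) :
    ∃ f : X → V, (∀ u, MeasurableSet {x | f x = u}) ∧
      ∀ j, ∫ x, ψ j (f x) x ∂m = ∫ x, ∑ u, ψ j u x * q x u ∂m := by
  have := Fintype.ofFinite J
  let w : X → ℝ := fun x => 1 + ∑ j, ∑ u, |ψ j u x|
  have hw : Integrable w m := (integrable_const 1).add <|
    integrable_finsetSum _ fun j _ => integrable_finsetSum _ fun u _ => (hψ j u).abs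
  have hψw : ∀ j u x, |ψ j u x| ≤ w x := by
    intro j u x
    have h1 := Finset.single_le_sum (f := fun u => |ψ j u x|) (fun u _ => abs_nonneg _)
      (Finset.mem_univ u)
    have h2 := Finset.single_le_sum (f := fun j => ∑ u, |ψ j u x|)
      (fun j _ => Finset.sum_nonneg fun u _ => abs_nonneg _) (Finset.mem_univ j)
    simp only [w] at *
    linarith
  have hw0 : ∀ x, 0 < w x := fun x => by positivity
  have hac : m.withDensity (fun x => ENNReal.ofReal (w x)) ≪ m :=
    withDensity_absolutelyContinuous _ _
  have := isFiniteMeasure_withDensity_ofReal hw.2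
  have hint : ∀ h : X → ℝ,
      ∫ x, h x / w x ∂m.withDensity (fun x => ENNReal.ofReal (w x)) = ∫ x, h x ∂m := by
    intro h
    refine (integral_withDensity_eq_integral_smul₀ hw.aemeasurable.real_toNNReal _).trans ?_
    refine integral_congr_ae (.of_forall fun x => ?_)
    simp only [NNReal.smul_def, Real.coe_toNNReal _ (hw0 x).le, smul_eq_mul]
    exact mul_div_cancel₀ _ (hw0 x).ne'
  obtain ⟨f, hf, hfψ⟩ := exists_purification_of_memLp_two
    (m := m.withDensity fun x => ENNReal.ofReal (w x)) (ψ := fun j u x => ψ j u x / w x)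
    (fun j u => .of_bound
      (((hψ j u).aemeasurable.div hw.aemeasurable).mono_ac hac).aestronglyMeasurable 1
      (.of_forall fun x => by
        rw [Real.norm_eq_abs, abs_div, abs_of_pos (hw0 x)]
        exact (div_le_one (hw0 x)).2 (hψw j u x))) hq hqs
  refine ⟨f, hf, fun j => ?_⟩
  rw [← hint, ← hint, hfψ]
  exact integral_congr_ae (.of_forall fun x => by
    simp only [Finset.sum_div, div_mul_eq_mul_div])

end purification

open Classical in
theorem stmt_12 {V : Type*} [Fintype V] [Nonempty V]
    {Ω : Type*} [MeasurableSpace Ω] (μ : Measure Ω) [IsProbabilityMeasure μ]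
    (G : Ω → V → ℝ) (hG : Measurable G)
    (ν : Measure ℝ) [IsProbabilityMeasure ν]
    -- `ν` is atomless and has a finite first moment
    (hatomless : ∀ x : ℝ, ν {x} = 0)
    (hmom : Integrable (fun x : ℝ => x) ν)
    -- the coordinates of `G` are i.i.d. with law `ν`
    (hlaw : Measure.map G μ = Measure.pi (fun _ : V => ν)) :
    -- purification: every randomized rule can be replaced by a deterministic
    -- one with the same objective value and the same marginal
    (∀ q : (V → ℝ) → V → ℝ, Measurable q → (∀ g, q g ∈ simplex V) →
      ∃ f : (V → ℝ) → V,
        (∀ u : V, MeasurableSet {g : V → ℝ | f g = u}) ∧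
        (∫ ω, G ω (f (G ω)) ∂μ) = (∫ ω, ∑ u, G ω u * q (G ω) u ∂μ) ∧
        (∀ u : V, (μ {ω | f (G ω) = u}).toReal = ∫ ω, q (G ω) u ∂μ)) ∧
    -- consequence: any solvable constrained problem admits an a.e. Dirac optimum
    (∀ (D : (V → ℝ) → (V → ℝ) → ℝ) (p : V → ℝ), p ∈ simplex V → ∀ ε : ℝ, 0 ≤ ε →
      (∃ q₀ : (V → ℝ) → V → ℝ, Measurable q₀ ∧ (∀ g, q₀ g ∈ simplex V) ∧
          D (fun u => ∫ ω, q₀ (G ω) u ∂μ) p ≤ ε ∧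
          (∀ q : (V → ℝ) → V → ℝ, Measurable q → (∀ g, q g ∈ simplex V) →
            D (fun u => ∫ ω, q (G ω) u ∂μ) p ≤ ε →
            ∫ ω, ∑ u, G ω u * q (G ω) u ∂μ ≤
              ∫ ω, ∑ u, G ω u * q₀ (G ω) u ∂μ)) →
      (∃ q' : (V → ℝ) → V → ℝ, Measurable q' ∧ (∀ g, q' g ∈ simplex V) ∧
          D (fun u => ∫ ω, q' (G ω) u ∂μ) p ≤ ε ∧
          (∀ q : (V → ℝ) → V → ℝ, Measurable q → (∀ g, q g ∈ simplex V) →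
            D (fun u => ∫ ω, q (G ω) u ∂μ) p ≤ ε →
            ∫ ω, ∑ u, G ω u * q (G ω) u ∂μ ≤
              ∫ ω, ∑ u, G ω u * q' (G ω) u ∂μ) ∧
          -- `q'(g)` is a Dirac point mass for almost every `g`
          (∀ᵐ g ∂(Measure.map G μ),
            ∃ u : V, q' g = fun v => if v = u then (1 : ℝ) else 0))) := by
  have hnull : NullSingletonClass ν := ⟨hatomless⟩
  have hexp : ∀ h : (V → ℝ) → ℝ, Measurable h →
      ∫ ω, h (G ω) ∂μ = ∫ g, h g ∂Measure.pi (fun _ : V => ν) := fun h hh => by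
    rw [← hlaw, integral_map hG.aemeasurable hh.aestronglyMeasurable]
  have hind : ∀ f : (V → ℝ) → V, (∀ u, MeasurableSet {g | f g = u}) →
      Measurable fun (g : V → ℝ) (u : V) => if u = f g then (1 : ℝ) else 0 := fun f hf =>
    measurable_pi_lambda _ fun u => Measurable.ite
      (by simpa only [eq_comm] using hf u) measurable_const measurable_const
  have hsel : ∀ (f : (V → ℝ) → V) (g : V → ℝ),
      ∑ u, g u * (if u = f g then (1 : ℝ) else 0) = g (f g) := fun f g => by simp
  have hprob : ∀ f : (V → ℝ) → V, (∀ u, MeasurableSet {g | f g = u}) → ∀ u,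
      ∫ ω, (if u = f (G ω) then (1 : ℝ) else 0) ∂μ = (μ {ω | f (G ω) = u}).toReal := by
    intro f hf u
    have hfG : MeasurableSet {ω | f (G ω) = u} := hG (hf u)
    rw [← measureReal_def, ← integral_indicator_one hfG]
    refine integral_congr_ae (.of_forall fun ω => ?_)
    simp [Set.indicator_apply, eq_comm]
  have hpure : ∀ q : (V → ℝ) → V → ℝ, Measurable q → (∀ g, q g ∈ simplex V) →
      ∃ f : (V → ℝ) → V,
        (∀ u : V, MeasurableSet {g : V → ℝ | f g = u}) ∧
        (∫ ω, G ω (f (G ω)) ∂μ) = (∫ ω, ∑ u, G ω u * q (G ω) u ∂μ) ∧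
        (∀ u : V, (μ {ω | f (G ω) = u}).toReal = ∫ ω, q (G ω) u ∂μ) := by
    intro q hq hqs
    obtain ⟨f, hf, hfψ⟩ := exists_purification_of_integrable
      (m := Measure.pi fun _ : V => ν)
      (ψ := fun (j : Option V) (u : V) (g : V → ℝ) =>
        j.elim (g u) fun v => if v = u then (1 : ℝ) else 0)
      (fun j u => by
        cases j with
        | none => exact integrable_comp_eval (μ := fun _ : V => ν) (i := u) hmom
        | some v => exact integrable_const _) hq hqs
    refine ⟨f, hf, ?_, fun u => ?_⟩
    · have hf' : Measurable fun g : V → ℝ => g (f g) := by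
        simp only [← hsel f]
        exact Finset.measurable_sum _ fun u _ => (measurable_pi_apply u).mul
          ((measurable_pi_apply u).comp (hind f hf))
      rw [hexp _ hf', hexp (fun g => ∑ u, g u * q g u) (by fun_prop)]
      exact hfψ none
    · rw [← hprob f hf, hexp (fun g => if u = f g then (1 : ℝ) else 0)
        ((measurable_pi_apply u).comp (hind f hf)), hexp (fun g => q g u) (by fun_prop)]
      simpa using hfψ (some u)
  refine ⟨hpure, fun D p _ ε _ ⟨q₀, hq₀, hq₀s, hD, hopt⟩ => ?_⟩
  obtain ⟨f, hf, hobj, hmarg⟩ := hpure q₀ hq₀ hq₀s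
  refine ⟨fun g u => if u = f g then 1 else 0, hind f hf, fun g => ⟨fun u => ?_, by simp⟩, ?_, ?_,
    .of_forall fun g => ⟨f g, rfl⟩⟩
  · dsimp only
    split_ifs <;> norm_num
  · simpa only [hprob f hf, hmarg] using hD
  · simpa only [hsel f, hobj] using hopt
end

section
/- Let Σ be a nonempty finite set, let p ∈ Δ(Σ) have full support, let g : Σ → ℝ, and let ε > 0. Consider maximizing the linear functional q ↦ Σ_{u∈Σ} g_u q_u over {q ∈ Δ(Σ) : χ²(q, p) ≤ ε}. Then there exist δ ≥ 0 and μ ∈ ℝ such that the distribution q* defined by q*_u = p_u·[1 + δ(g_u + μ)]_+ (where [x]_+ = max(0,x)) lies in Δ(Σ) and is an optimal solution; moreover δ can be chosen so that χ²(q*, p) = ε, unless the greedy solution (supported on argmax g) is already feasible. -/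
open Finset

/-- χ² distance `χ²(q, p) = ∑ u, (q u − p u)² / p u`. -/
noncomputable def chiSq {V : Type*} [Fintype V] (q p : V → ℝ) : ℝ :=
  ∑ u, (q u - p u) ^ 2 / p u

/-- A truncated affine tilt of `p` maximizes the linear functional `g` among all distributions
whose χ² distance to `p` does not exceed its own. -/
theorem sum_mul_le_of_chiSq_le {V : Type*} [Fintype V] {p g q : V → ℝ} {δ μ : ℝ}
    (hp : ∀ u, 0 < p u) (hδ : 0 < δ)
    (hs : (fun u => p u * max 0 (1 + δ * (g u + μ))) ∈ simplex V) (hq : q ∈ simplex V)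
    (hle : chiSq q p ≤ chiSq (fun u => p u * max 0 (1 + δ * (g u + μ))) p) :
    ∑ u, g u * q u ≤ ∑ u, g u * (p u * max 0 (1 + δ * (g u + μ))) := by
  set w : V → ℝ := fun u => p u * max 0 (1 + δ * (g u + μ)) with hw
  have pointwise (u : V) : 2 * δ * (g u * q u) - 2 * δ * (g u * w u) ≤
      (q u - p u) ^ 2 / p u - (w u - p u) ^ 2 / p u - 2 * δ * μ * (q u - w u) := by
    have hpu := hp u
    have h_slack : (q u - w u) * (1 + δ * (g u + μ)) ≤
        (q u - w u) * max 0 (1 + δ * (g u + μ)) := by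
      rcases le_total 0 (1 + δ * (g u + μ)) with h | h
      · rw [max_eq_right h]
      · have : w u = 0 := by simp [hw, max_eq_left h]
        rw [max_eq_left h, this]
        nlinarith [hq.1 u]
    have h_sq : 0 ≤ (q u - w u) ^ 2 / p u := by positivity
    have expand : (q u - p u) ^ 2 / p u - (w u - p u) ^ 2 / p u =
        (q u - w u) ^ 2 / p u + 2 * ((q u - w u) * max 0 (1 + δ * (g u + μ)))
          - 2 * (q u - w u) := by
      simp only [hw]
      field_simp
      ring
    linarith
  have h_sum := sum_le_sum fun u (_ : u ∈ univ) => pointwise u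
  simp only [sum_sub_distrib, ← mul_sum] at h_sum
  rw [hq.2, hs.2] at h_sum
  unfold chiSq at hle
  have : 2 * δ * (∑ u, g u * q u) ≤ 2 * δ * ∑ u, g u * w u := by linarith
  exact le_of_mul_le_mul_left this (by positivity)

theorem stmt_13 {V : Type*} [Fintype V] [Nonempty V]
    (p : V → ℝ) (hp : p ∈ simplex V) (hppos : ∀ u, 0 < p u)
    (g : V → ℝ) (ε : ℝ) (hε : 0 < ε) :
    ∃ (δ : ℝ) (μ : ℝ), 0 ≤ δ ∧
      -- `q*_u = p_u [1 + δ (g_u + μ)]₊` is a feasible distribution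
      (fun u => p u * max 0 (1 + δ * (g u + μ))) ∈ simplex V ∧
      chiSq (fun u => p u * max 0 (1 + δ * (g u + μ))) p ≤ ε ∧
      -- and it is an optimal solution
      (∀ q ∈ simplex V, chiSq q p ≤ ε →
        ∑ u, g u * q u ≤ ∑ u, g u * (p u * max 0 (1 + δ * (g u + μ)))) ∧
      -- `δ` saturates the χ² constraint, unless a greedy solution (supported
      -- on the argmax of `g`) is already feasible
      (chiSq (fun u => p u * max 0 (1 + δ * (g u + μ))) p = ε ∨
        ∃ q₀ ∈ simplex V, (∀ u, q₀ u ≠ 0 → ∀ v, g v ≤ g u) ∧ chiSq q₀ p ≤ ε) := by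
  obtain ⟨a, ha⟩ := Finite.exists_max g
  set m : ℝ → V → ℝ := fun s u => max 0 (1 - s * (g a - g u)) with hm
  set G : ℝ → ℝ := fun s => ∑ u, p u * m s u with hG
  have m_nonneg (s : ℝ) (u : V) : 0 ≤ m s u := le_max_left _ _
  have G_pos (s : ℝ) : 0 < G s :=
    sum_pos' (fun u _ => mul_nonneg (hppos u).le (m_nonneg s u))
      ⟨a, mem_univ a, by simpa [hm] using hppos a⟩
  set Q : ℝ → V → ℝ := fun s u => p u * m s u / G s with hQ
  have Q_mem (s : ℝ) : Q s ∈ simplex V := by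
    refine ⟨fun u => div_nonneg (mul_nonneg (hppos u).le (m_nonneg s u)) (G_pos s).le, ?_⟩
    simp only [hQ, ← sum_div]
    exact div_self (G_pos s).ne'
  have Q_eq {s : ℝ} (hs : 0 < s) : ∃ δ μ : ℝ, 0 < δ ∧
      Q s = fun u => p u * max 0 (1 + δ * (g u + μ)) := by
    have hGs := G_pos s
    refine ⟨s / G s, (1 - s * g a - G s) / s, div_pos hs hGs, funext fun u => ?_⟩
    have h_arg : 1 + s / G s * (g u + (1 - s * g a - G s) / s) =
        (1 - s * (g a - g u)) / G s := by
      field_simp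
      ring
    have h_max : max 0 ((1 - s * (g a - g u)) / G s) = m s u / G s := by
      simpa using max_div_div_right hGs.le 0 (1 - s * (g a - g u))
    rw [h_arg, h_max]
    exact mul_div_assoc _ _ _
  have chi_cont : Continuous fun s => chiSq (Q s) p := by
    have G_cont : Continuous G := by fun_prop
    have Q_cont (u : V) : Continuous fun s => Q s u :=
      Continuous.div (by fun_prop) G_cont fun s => (G_pos s).ne'
    unfold chiSq
    exact continuous_finsetSum _ fun u _ => (((Q_cont u).sub continuous_const).pow 2).div_const _
  have chi_zero : chiSq (Q 0) p = 0 := by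
    have : Q 0 = p := by
      ext u
      simp [hQ, hG, hm, hp.2]
    simp [chiSq, this]
  obtain ⟨S, hS, hS_one⟩ : ∃ S : ℝ, 0 < S ∧ ∀ u, g u < g a → 1 ≤ S * (g a - g u) := by
    have inv_nonneg' (u : V) : 0 ≤ (g a - g u)⁻¹ := inv_nonneg.2 (sub_nonneg.2 (ha u))
    refine ⟨1 + ∑ u, (g a - g u)⁻¹, ?_, fun u hu => ?_⟩
    · have := sum_nonneg fun u (_ : u ∈ univ) => inv_nonneg' u
      linarith
    · have := single_le_sum (fun v _ => inv_nonneg' v) (mem_univ u)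
      rw [← div_le_iff₀ (sub_pos.2 hu), one_div]
      linarith
  rcases le_or_gt (chiSq (Q S) p) ε with h_greedy | h_greedy
  · have supp (u : V) (hu : Q S u ≠ 0) : g u = g a := by
      by_contra h
      have := hS_one u (lt_of_le_of_ne (ha u) h)
      exact hu (by simp [hQ, hm, max_eq_left (sub_nonpos.2 this)])
    obtain ⟨δ, μ, hδ, h_eq⟩ := Q_eq hS
    have value : ∑ u, g u * Q S u = g a := by
      have (u : V) : g u * Q S u = g a * Q S u := by
        by_cases h : Q S u = 0
        · simp [h]
        · rw [supp u h]
      simp only [this, ← mul_sum, (Q_mem S).2, mul_one]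
    have greedy : ∃ q₀ ∈ simplex V, (∀ u, q₀ u ≠ 0 → ∀ v, g v ≤ g u) ∧ chiSq q₀ p ≤ ε :=
      ⟨Q S, Q_mem S, fun u hu v => (supp u hu).symm ▸ ha v, h_greedy⟩
    refine ⟨δ, μ, hδ.le, h_eq ▸ Q_mem S, h_eq ▸ h_greedy, fun q hq _ => ?_, Or.inr greedy⟩
    calc ∑ u, g u * q u ≤ ∑ u, g a * q u :=
          sum_le_sum fun u _ => mul_le_mul_of_nonneg_right (ha u) (hq.1 u)
      _ = ∑ u, g u * Q S u := by rw [← mul_sum, hq.2, mul_one, value]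
      _ = _ := by rw [h_eq]
  · obtain ⟨s, hs, h_chi⟩ := intermediate_value_Icc hS.le chi_cont.continuousOn
      (show ε ∈ Set.Icc (chiSq (Q 0) p) (chiSq (Q S) p) from ⟨chi_zero.trans_le hε.le, h_greedy.le⟩)
    have s_pos : 0 < s := hs.1.lt_of_ne' fun h => by
      simp only [h, chi_zero] at h_chi
      exact hε.ne h_chi
    obtain ⟨δ, μ, hδ, h_eq⟩ := Q_eq s_pos
    have mem := Q_mem s
    simp only [h_eq] at h_chi mem
    exact ⟨δ, μ, hδ.le, mem, h_chi.le, fun q hq h_le =>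
      sum_mul_le_of_chiSq_le hppos hδ mem hq (h_le.trans_eq h_chi.symm), Or.inl h_chi⟩
end
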